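/- arXiv:1403.7878 — 8 statements merged into one kernel-verified Lean document; each statement's English description precedes it below -/
import Mathlib

section
/- Let k be a positive integer, let s ≥ 3 be an integer, and let λ be an odd positive integer. Then ρ_{k,λ}(2^s) = 2^{(s-3)(k-1)} · ρ_{k,λ}(8). -/
/-- `rho k lam n` is the number of `k`-tuples `(x_1,…,x_k) ∈ (ℤ/nℤ)^k`
with `x_1² + ⋯ + x_k² ≡ lam (mod n)`. -/
noncomputable def rho (k : ℕ) (lam : ℤ) (n : ℕ) : ℕ :=
  Nat.card {x : Fin k → ZMod n // ∑ i, (x i) ^ 2 = (lam : ZMod n)}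

theorem Finset.card_filter_comp_addMonoidHom {G H : Type*} [AddGroup G] [AddGroup H]
    [Fintype G] [Fintype H] [DecidableEq H] (F : G →+ H) (hF : Function.Surjective F)
    {c : ℕ} (hc : Fintype.card G = c * Fintype.card H) (p : H → Prop) [DecidablePred p] :
    (Finset.univ.filter fun x => p (F x)).card = c * (Finset.univ.filter p).card := by
  have key : ∀ b : H, (Finset.univ.filter fun x => F x = b).card =
      (Finset.univ.filter fun x => F x = 0).card := fun b =>
    AddMonoidHom.card_fiber_eq_of_mem_range F (hF b) (hF 0)
  have total : Fintype.card G =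
      Fintype.card H * (Finset.univ.filter fun x => F x = 0).card := by
    rw [← Finset.card_univ, Finset.card_eq_sum_card_fiberwise (f := F) (t := Finset.univ)
      (fun _ _ => Finset.mem_coe.2 (Finset.mem_univ _))]
    simp [key]
  have hpos : 0 < Fintype.card H := Fintype.card_pos
  have hfib : (Finset.univ.filter fun x => F x = 0).card = c :=
    Nat.eq_of_mul_eq_mul_left hpos (by rw [← total, hc, mul_comm])
  rw [Finset.card_eq_sum_card_fiberwise (f := F) (t := Finset.univ.filter p)
    (fun x hx => by simpa using hx), Finset.sum_congr rfl (g := fun _ => c)]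
  · simp [mul_comm]
  · intro b hb
    rw [← hfib, ← key b, Finset.filter_filter]
    congr 1
    ext x
    simp only [Finset.mem_filter, Finset.mem_univ, true_and] at hb ⊢
    constructor
    · exact fun h => h.2
    · rintro rfl
      exact ⟨hb, rfl⟩

theorem ZMod.castHom_two_mul_eq_zero_iff (m : ℕ) [NeZero m] (y : ZMod (2 * m)) :
    ZMod.castHom (dvd_mul_left m 2) (ZMod m) y = 0 ↔ y = 0 ∨ y = (m : ZMod (2 * m)) := by
  obtain ⟨a, ha, rfl⟩ : ∃ a < 2 * m, (a : ZMod (2 * m)) = y :=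
    ⟨y.val, ZMod.val_lt y, ZMod.natCast_zmod_val y⟩
  rw [map_natCast, ZMod.natCast_eq_zero_iff]
  constructor
  · rintro ⟨b, rfl⟩
    have : b < 2 := by
      by_contra! h
      nlinarith [Nat.mul_le_mul_left m h]
    interval_cases b <;> simp
  · rintro (h | h)
    · exact (dvd_mul_left m 2).trans ((ZMod.natCast_eq_zero_iff _ _).1 h)
    · rw [ZMod.natCast_eq_natCast_iff] at h
      exact (Nat.modEq_zero_iff_dvd).1
        ((h.of_mul_left 2).trans ((Nat.modEq_zero_iff_dvd).2 dvd_rfl))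

theorem rho_eq_card_filter (k : ℕ) (lam : ℤ) (n : ℕ) [NeZero n] :
    rho k lam n =
      (Finset.univ.filter fun x : Fin k → ZMod n => ∑ i, (x i) ^ 2 = (lam : ZMod n)).card := by
  rw [rho, Nat.card_eq_fintype_card, Fintype.card_subtype]

/-- Scaling by the unit `u` carries solutions for `lam` to solutions for `u ^ 2 * lam`. -/
theorem card_sum_sq_eq_of_isUnit {R : Type*} [CommRing R] [Fintype R] [DecidableEq R] (k : ℕ)
    (u : Rˣ) (a : R) :
    (Finset.univ.filter fun x : Fin k → R => ∑ i, (x i) ^ 2 = (u : R) ^ 2 * a).card =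
      (Finset.univ.filter fun x : Fin k → R => ∑ i, (x i) ^ 2 = a).card := by
  symm
  refine Finset.card_equiv (MulAction.toPerm u) fun x => ?_
  simp only [Finset.mem_filter, Finset.mem_univ, true_and, MulAction.toPerm_apply, Pi.smul_apply,
    Units.smul_def, smul_eq_mul, mul_pow, ← Finset.mul_sum]
  exact ((u.isUnit.pow 2).mul_right_inj).symm

theorem two_mul_rho_two_mul_two_pow (k s : ℕ) (hs : 3 ≤ s) (lam : ℤ) (hodd : Odd lam) :
    2 * rho k lam (2 * 2 ^ s) = 2 ^ k * rho k lam (2 ^ s) := by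
  have hm : ((2 * 2 ^ s : ℕ) : ZMod (2 * 2 ^ s)) = 0 := ZMod.natCast_self _
  push_cast at hm
  obtain ⟨t, rfl⟩ : ∃ t, s = t + 3 := ⟨s - 3, by omega⟩
  set R := ZMod (2 * 2 ^ (t + 3)) with hR
  have hw : (2 : R) ^ (t + 2) * 2 ^ (t + 2) = 0 := by
    linear_combination (2 : R) ^ t * hm
  have hu : (1 + 2 ^ (t + 2) : R) * (1 - 2 ^ (t + 2)) = 1 := by linear_combination -hw
  let u : Rˣ := Units.mkOfMulEqOne _ _ hu
  obtain ⟨l, hl⟩ := hodd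
  have hul : (u : R) ^ 2 * (lam : R) = lam + 2 ^ (t + 3) := by
    change (1 + 2 ^ (t + 2) : R) ^ 2 * (lam : R) = lam + 2 ^ (t + 3)
    rw [hl]
    push_cast
    linear_combination (2 * (l : R) + 1) * hw + (l : R) * hm
  have hscale := card_sum_sq_eq_of_isUnit k u (lam : R)
  rw [hul] at hscale
  let f := ZMod.castHom (dvd_mul_left (2 ^ (t + 3)) 2) (ZMod (2 ^ (t + 3)))
  have hf : Function.Surjective f := ZMod.castHom_surjective _
  have hne : (2 : R) ^ (t + 3) ≠ 0 := by
    intro h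
    have h' : ((2 ^ (t + 3) : ℕ) : R) = 0 := by exact_mod_cast h
    have := Nat.le_of_dvd (by positivity) ((ZMod.natCast_eq_zero_iff _ _).1 h')
    have : 0 < 2 ^ (t + 3) := by positivity
    omega
  have hlift := Finset.card_filter_comp_addMonoidHom
    (f.toAddMonoidHom.compLeft (Fin k)) hf.comp_left (c := 2 ^ k)
    (by simp [ZMod.card, mul_pow])
    (fun x => ∑ i, (x i) ^ 2 = (lam : ZMod (2 ^ (t + 3))))
  rw [rho_eq_card_filter, rho_eq_card_filter, ← hlift, two_mul]
  nth_rewrite 2 [← hscale]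
  rw [← Finset.card_union_of_disjoint, ← Finset.filter_or]
  · congr 1
    ext x
    simp only [Finset.mem_filter, Finset.mem_univ, true_and]
    have h := ZMod.castHom_two_mul_eq_zero_iff (2 ^ (t + 3)) (∑ i, (x i) ^ 2 - (lam : R))
    rw [map_sub, map_sum, map_intCast, sub_eq_zero, sub_eq_zero, sub_eq_iff_eq_add'] at h
    push_cast at h
    rw [← h]
    simp [f]
  · rw [Finset.disjoint_filter]
    rintro x - h h'
    exact hne (by simpa [h] using h')

theorem rho_two_pow (k : ℕ) (hk : 0 < k) (s : ℕ) (hs : 3 ≤ s)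
    (lam : ℕ) (hlam : 0 < lam) (hodd : Odd lam) :
    rho k (lam : ℤ) (2 ^ s) = 2 ^ ((s - 3) * (k - 1)) * rho k (lam : ℤ) 8 := by
  obtain ⟨j, rfl⟩ : ∃ j, k = j + 1 := ⟨k - 1, by omega⟩
  induction s, hs using Nat.le_induction with
  | base => norm_num
  | succ s hs ih =>
    have h := two_mul_rho_two_mul_two_pow (j + 1) s hs lam (by exact_mod_cast hodd)
    rw [pow_succ 2 j, mul_comm _ 2, mul_assoc] at h
    rw [pow_succ', Nat.eq_of_mul_eq_mul_left two_pos h, ih, Nat.succ_sub hs, Nat.succ_mul,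
      Nat.add_sub_cancel, pow_add]
    ring
end

section
/- For every positive integer k, the equality ρ_{k,1}(4) = 4^{k-1} + 2^{(3k-2)/2} · sin(πk/4) holds in the real numbers, where 2^{(3k-2)/2} denotes the real power 2^{(3k-2)/2}. -/
/-- The recurrence for counting representations as sums of squares, splitting off the first
variable. -/
theorem card_sum_sq_succ (n : ℕ) [NeZero n] (k : ℕ) (a : ZMod n) :
    Nat.card {x : Fin (k + 1) → ZMod n // ∑ i, (x i) ^ 2 = a} =
      ∑ y : ZMod n, Nat.card {x : Fin k → ZMod n // ∑ i, (x i) ^ 2 = a - y ^ 2} := by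
  classical
  simp only [Nat.card_eq_fintype_card, Fintype.card_subtype, Finset.card_filter]
  rw [← (Fin.consEquiv fun _ : Fin (k + 1) => ZMod n).sum_comp, Fintype.sum_prod_type]
  simp [Fin.consEquiv, Fin.sum_univ_succ, eq_sub_iff_add_eq']

theorem card_sum_sq_zmod_four_succ (k : ℕ) (a : ZMod 4) :
    Nat.card {x : Fin (k + 1) → ZMod 4 // ∑ i, (x i) ^ 2 = a} =
      2 * Nat.card {x : Fin k → ZMod 4 // ∑ i, (x i) ^ 2 = a} +
        2 * Nat.card {x : Fin k → ZMod 4 // ∑ i, (x i) ^ 2 = a - 1} := by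
  have sum_eq (f : ZMod 4 → ℕ) : ∑ y : ZMod 4, f y = f 0 + f 1 + f 2 + f 3 :=
    Fin.sum_univ_four f
  have h₀ : a - 0 ^ 2 = a := by ring
  have h₁ : a - 1 ^ 2 = a - 1 := by ring
  have h₂ : a - 2 ^ 2 = a := by revert a; decide
  have h₃ : a - 3 ^ 2 = a - 1 := by revert a; decide
  rw [card_sum_sq_succ, sum_eq, h₀, h₁, h₂, h₃]
  ring

open Real in
theorem card_sum_sq_zmod_four (k : ℕ) :
    ((Nat.card {x : Fin (k + 1) → ZMod 4 // ∑ i, (x i) ^ 2 = 0} : ℝ) =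
      4 ^ k + (2 * √2) ^ (k + 1) / 2 * cos ((k + 1 : ℕ) * (π / 4))) ∧
    ((Nat.card {x : Fin (k + 1) → ZMod 4 // ∑ i, (x i) ^ 2 = 1} : ℝ) =
      4 ^ k + (2 * √2) ^ (k + 1) / 2 * sin ((k + 1 : ℕ) * (π / 4))) ∧
    ((Nat.card {x : Fin (k + 1) → ZMod 4 // ∑ i, (x i) ^ 2 = 2} : ℝ) =
      4 ^ k - (2 * √2) ^ (k + 1) / 2 * cos ((k + 1 : ℕ) * (π / 4))) ∧
    ((Nat.card {x : Fin (k + 1) → ZMod 4 // ∑ i, (x i) ^ 2 = 3} : ℝ) =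
      4 ^ k - (2 * √2) ^ (k + 1) / 2 * sin ((k + 1 : ℕ) * (π / 4))) := by
  have hsq : √2 * √2 = 2 := mul_self_sqrt zero_le_two
  have h₀ : (0 - 1 : ZMod 4) = 3 := by decide
  have h₁ : (1 - 1 : ZMod 4) = 0 := by decide
  have h₂ : (2 - 1 : ZMod 4) = 1 := by decide
  have h₃ : (3 - 1 : ZMod 4) = 2 := by decide
  induction k with
  | zero =>
    have h (a : ZMod 4) : Nat.card {x : Fin 0 → ZMod 4 // ∑ i, (x i) ^ 2 = a} =
        if 0 = a then 1 else 0 := by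
      split_ifs with ha <;> simp [ha]
    have d₁ : (0 : ZMod 4) ≠ 1 := by decide
    have d₂ : (0 : ZMod 4) ≠ 2 := by decide
    have d₃ : (0 : ZMod 4) ≠ 3 := by decide
    simp only [card_sum_sq_zmod_four_succ, h₀, h₁, h₂, h₃, h, d₁, d₂, d₃, if_true, if_false,
      zero_add, Nat.cast_one, one_mul, pow_one, pow_zero, cos_pi_div_four, sin_pi_div_four]
    refine ⟨?_, ?_, ?_, ?_⟩ <;> push_cast <;> linarith
  | succ k ih =>
    obtain ⟨i₀, i₁, i₂, i₃⟩ := ih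
    have e : ((k + 1 + 1 : ℕ) : ℝ) * (π / 4) = (k + 1 : ℕ) * (π / 4) + π / 4 := by
      push_cast; ring
    simp only [card_sum_sq_zmod_four_succ (k + 1), h₀, h₁, h₂, h₃, Nat.cast_add (2 * _),
      Nat.cast_mul, Nat.cast_ofNat, i₀, i₁, i₂, i₃, e, cos_add, sin_add, cos_pi_div_four,
      sin_pi_div_four, pow_succ _ (k + 1)]
    refine ⟨?_, ?_, ?_, ?_⟩ <;> grind

open Real in
theorem rho_one_four (k : ℕ) (hk : 0 < k) :
    (rho k 1 4 : ℝ) =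
      4 ^ (k - 1) + (2 : ℝ) ^ ((3 * (k : ℝ) - 2) / 2) * Real.sin (π * k / 4) := by
  obtain ⟨k, rfl⟩ := Nat.exists_eq_add_of_le' hk
  have hpow : (2 : ℝ) ^ ((3 * ((k + 1 : ℕ) : ℝ) - 2) / 2) = (2 * √2) ^ (k + 1) / 2 := by
    have h : (2 * √2 : ℝ) = 2 ^ (3 / 2 : ℝ) := by
      rw [sqrt_eq_rpow, ← rpow_one_add' zero_le_two (by norm_num)]
      norm_num
    rw [h, ← rpow_mul_natCast zero_le_two, ← rpow_sub_one two_ne_zero]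
    congr 1
    ring
  rw [hpow, mul_comm π, mul_div_assoc, Nat.add_sub_cancel, rho, Int.cast_one]
  exact (card_sum_sq_zmod_four k).2.1
end

section
/- For every positive integer k, the equality ρ_{k,3}(4) = 4^{k-1} − 2^{(3k-2)/2} · sin(πk/4) holds in the real numbers, where 2^{(3k-2)/2} denotes the real power 2^{(3k-2)/2}. -/
/-- The number of representations of `a : ZMod n` as an ordered sum of `k` squares. -/
noncomputable def sumSqCount (k n : ℕ) (a : ZMod n) : ℕ :=
  Nat.card {x : Fin k → ZMod n // ∑ i, (x i) ^ 2 = a}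

theorem sumSqCount_zero (n : ℕ) (a : ZMod n) [Decidable (0 = a)] :
    sumSqCount 0 n a = if 0 = a then 1 else 0 := by
  unfold sumSqCount
  split_ifs with h <;> simp [h]

theorem sumSqCount_succ (k n : ℕ) [NeZero n] (a : ZMod n) :
    sumSqCount (k + 1) n a = ∑ y : ZMod n, sumSqCount k n (a - y ^ 2) := by
  unfold sumSqCount
  rw [← Nat.card_sigma]
  refine Nat.card_congr
    { toFun := fun x => ⟨x.1 0, fun i => x.1 i.succ, ?_⟩
      invFun := fun p => ⟨Fin.cons p.1 p.2.1, ?_⟩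
      left_inv := fun x => Subtype.ext (Fin.cons_self_tail x.1)
      right_inv := fun ⟨_, _, _⟩ => rfl }
  · rw [eq_sub_iff_add_eq', ← Fin.sum_univ_succ (fun i => x.1 i ^ 2)]
    exact x.2
  · simp [Fin.sum_univ_succ, p.2.2]

theorem sumSqCount_succ_four (k : ℕ) (a : ZMod 4) :
    sumSqCount (k + 1) 4 a = 2 * sumSqCount k 4 a + 2 * sumSqCount k 4 (a - 1) := by
  have h2 : (2 : ZMod 4) ^ 2 = 0 := by decide
  have h3 : (3 : ZMod 4) ^ 2 = 1 := by decide
  have h : ∑ y : ZMod 4, sumSqCount k 4 (a - y ^ 2) =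
      sumSqCount k 4 (a - 0 ^ 2) + sumSqCount k 4 (a - 1 ^ 2) +
        sumSqCount k 4 (a - 2 ^ 2) + sumSqCount k 4 (a - 3 ^ 2) :=
    Fin.sum_univ_four fun y : ZMod 4 => sumSqCount k 4 (a - y ^ 2)
  rw [sumSqCount_succ, h, h2, h3]
  simp only [one_pow, ne_eq, OfNat.ofNat_ne_zero, not_false_eq_true, zero_pow, sub_zero]
  ring

/-- The counts modulo `4` in terms of the real and imaginary parts of `(2 + 2i) ^ (k + 1)`. -/
theorem four_mul_sumSqCount (k : ℕ) :
    (4 * sumSqCount (k + 1) 4 0 : ℝ) = 4 ^ (k + 1) +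
        2 * (√8 ^ (k + 1) * Real.cos ((k + 1 : ℕ) * (Real.pi / 4))) ∧
      (4 * sumSqCount (k + 1) 4 1 : ℝ) = 4 ^ (k + 1) +
        2 * (√8 ^ (k + 1) * Real.sin ((k + 1 : ℕ) * (Real.pi / 4))) ∧
      (4 * sumSqCount (k + 1) 4 2 : ℝ) = 4 ^ (k + 1) -
        2 * (√8 ^ (k + 1) * Real.cos ((k + 1 : ℕ) * (Real.pi / 4))) ∧
      (4 * sumSqCount (k + 1) 4 3 : ℝ) = 4 ^ (k + 1) -
        2 * (√8 ^ (k + 1) * Real.sin ((k + 1 : ℕ) * (Real.pi / 4))) := by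
  have hr : √8 * (√2 / 2) = 2 := by
    rw [← mul_div_assoc, ← Real.sqrt_mul (by norm_num),
      show (8 * 2 : ℝ) = 4 ^ 2 by norm_num, Real.sqrt_sq (by norm_num)]
    norm_num
  have s0 : (0 - 1 : ZMod 4) = 3 := by decide
  have s1 : (1 - 1 : ZMod 4) = 0 := by decide
  have s2 : (2 - 1 : ZMod 4) = 1 := by decide
  have s3 : (3 - 1 : ZMod 4) = 2 := by decide
  induction k with
  | zero =>
    have e1 : ¬ (0 : ZMod 4) = 1 := by decide
    have e2 : ¬ (0 : ZMod 4) = 2 := by decide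
    have e3 : ¬ (0 : ZMod 4) = 3 := by decide
    simp only [sumSqCount_succ_four, s0, s1, s2, s3, sumSqCount_zero, e1, e2, e3, if_true,
      if_false, zero_add, pow_one, Nat.cast_one, one_mul, Real.cos_pi_div_four,
      Real.sin_pi_div_four, hr]
    norm_num
  | succ k ih =>
    obtain ⟨h0, h1, h2, h3⟩ := ih
    have ha : ((k + 1 + 1 : ℕ) : ℝ) * (Real.pi / 4) =
        (k + 1 : ℕ) * (Real.pi / 4) + Real.pi / 4 := by
      push_cast; ring
    rw [ha, Real.cos_add, Real.sin_add, Real.cos_pi_div_four, Real.sin_pi_div_four]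
    generalize Real.cos ((k + 1 : ℕ) * (Real.pi / 4)) = c at *
    generalize Real.sin ((k + 1 : ℕ) * (Real.pi / 4)) = s at *
    have hc : √8 ^ (k + 1 + 1) * (c * (√2 / 2) - s * (√2 / 2)) =
        2 * (√8 ^ (k + 1) * c) - 2 * (√8 ^ (k + 1) * s) := by
      linear_combination √8 ^ (k + 1) * (c - s) * hr
    have hs : √8 ^ (k + 1 + 1) * (s * (√2 / 2) + c * (√2 / 2)) =
        2 * (√8 ^ (k + 1) * c) + 2 * (√8 ^ (k + 1) * s) := by
      linear_combination √8 ^ (k + 1) * (c + s) * hr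
    rw [hc, hs, pow_succ (4 : ℝ) (k + 1)]
    simp only [sumSqCount_succ_four (k + 1), s0, s1, s2, s3]
    push_cast
    refine ⟨?_, ?_, ?_, ?_⟩ <;> linarith

open Real in
theorem rho_three_four (k : ℕ) (hk : 0 < k) :
    (rho k 3 4 : ℝ) =
      4 ^ (k - 1) - (2 : ℝ) ^ ((3 * (k : ℝ) - 2) / 2) * Real.sin (π * k / 4) := by
  obtain ⟨k, rfl⟩ := Nat.exists_eq_add_of_lt hk
  rw [zero_add]
  have h := (four_mul_sumSqCount k).2.2.2
  have hrho : rho (k + 1) 3 4 = sumSqCount (k + 1) 4 3 := by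
    unfold rho sumSqCount
    norm_cast
  have hpow : (2 : ℝ) ^ ((3 * ((k + 1 : ℕ) : ℝ) - 2) / 2) = √8 ^ (k + 1) / 2 := by
    rw [sqrt_eq_rpow, show (8 : ℝ) = 2 ^ (3 : ℝ) by norm_num, ← rpow_mul (by norm_num),
      ← rpow_mul_natCast (by norm_num), ← rpow_sub_one (by norm_num)]
    congr 1
    ring
  have hang : π * ((k + 1 : ℕ) : ℝ) / 4 = (k + 1 : ℕ) * (π / 4) := by ring
  rw [hrho, hpow, hang, Nat.add_sub_cancel]
  rw [pow_succ (4 : ℝ)] at h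
  linarith
end

section
/- For every positive integer k, the equality ρ_{k,1}(8) = 2^{2k-3} · ( 2^k + 2^{k/2+1}·sin(πk/4) + 2·sin(π(k+1)/4) − 2·cos(π(3k+1)/4) ) holds in the real numbers, where 2^{k/2+1} denotes the real power 2^{k/2+1}. -/
/-- An additive character maps finite sums to finite products. -/
theorem AddChar.map_sum_eq_prod_map {ι A M : Type*} [AddCommMonoid A] [CommMonoid M]
    (ψ : AddChar A M) (s : Finset ι) (f : ι → A) : ψ (∑ i ∈ s, f i) = ∏ i ∈ s, ψ (f i) :=
  map_prod ψ.toMonoidHom (fun i ↦ Multiplicative.ofAdd (f i)) s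

open Finset in
/-- Counting solutions of `x_1² + ⋯ + x_k² = lam` in `ℤ/nℤ` by quadratic Gauss sums. -/
theorem rho_mul_eq_sum_gaussSum_pow (k : ℕ) (lam : ℤ) (n : ℕ) [NeZero n] :
    (n : ℂ) * rho k lam n =
      ∑ a : ZMod n, (∑ x : ZMod n, ZMod.stdAddChar (a * x ^ 2)) ^ k *
        ZMod.stdAddChar (a * (-(lam : ZMod n))) := by
  classical
  have hpow (a : ZMod n) :
      (∑ x : ZMod n, (ZMod.stdAddChar (a * x ^ 2) : ℂ)) ^ k *
          ZMod.stdAddChar (a * (-(lam : ZMod n))) =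
        ∑ x : Fin k → ZMod n, ZMod.stdAddChar (a * (∑ i, x i ^ 2 - (lam : ZMod n))) := by
    rw [Fintype.sum_pow, sum_mul]
    refine sum_congr rfl fun x _ ↦ ?_
    rw [← AddChar.map_sum_eq_prod_map, ← AddChar.map_add_eq_mul, ← mul_sum, ← mul_add,
      ← sub_eq_add_neg]
  simp_rw [hpow]
  rw [sum_comm]
  simp_rw [AddChar.sum_mulShift _ (ZMod.isPrimitive_stdAddChar n), sub_eq_zero]
  rw [rho, Nat.card_eq_fintype_card, Fintype.card_subtype, ZMod.card]
  simp [sum_ite, mul_comm]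

/-- The number of representations of `1` as a sum of `k` squares modulo `8`, in terms of a
primitive eighth root of unity. -/
theorem eight_mul_rho_one_eight {k : ℕ} (hk : 0 < k) {w : ℂ}
    (hw : w = ZMod.stdAddChar (1 : ZMod 8)) (hw4 : w ^ 4 = -1) :
    (8 : ℂ) * rho k 1 8 =
      8 ^ k + 4 ^ k * ((1 + w ^ 2) ^ k * w ^ 6 + (1 + w ^ 6) ^ k * w ^ 2 +
        (w ^ k * w ^ 7 + (w ^ 3) ^ k * w ^ 5 + (w ^ 5) ^ k * w ^ 3 + (w ^ 7) ^ k * w)) := by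
  have hchar (j : ℕ) : (ZMod.stdAddChar ((j : ℕ) : ZMod 8) : ℂ) = w ^ j := by
    rw [hw, ← AddChar.map_nsmul_eq_pow, nsmul_one]
  have hchar' (a : ZMod 8) : (ZMod.stdAddChar a : ℂ) = w ^ a.val := by
    rw [← hchar, ZMod.natCast_zmod_val]
  have hsum (f : ZMod 8 → ℂ) :
      ∑ a, f a = f 0 + f 1 + f 2 + f 3 + f 4 + f 5 + f 6 + f 7 := Fin.sum_univ_eight f
  have hgauss (a : ZMod 8) : ∑ x : ZMod 8, (ZMod.stdAddChar (a * x ^ 2) : ℂ) =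
      2 + 4 * w ^ a.val + 2 * w ^ (4 * a).val := by
    have e0 : a * 0 ^ 2 = 0 := by revert a; decide
    have e1 : a * 1 ^ 2 = a := by revert a; decide
    have e2 : a * 2 ^ 2 = 4 * a := by revert a; decide
    have e3 : a * 3 ^ 2 = a := by revert a; decide
    have e4 : a * 4 ^ 2 = 0 := by revert a; decide
    have e5 : a * 5 ^ 2 = a := by revert a; decide
    have e6 : a * 6 ^ 2 = 4 * a := by revert a; decide
    have e7 : a * 7 ^ 2 = a := by revert a; decide
    rw [hsum, e0, e1, e2, e3, e4, e5, e6, e7, AddChar.map_zero_eq_one, hchar' a, hchar' (4 * a)]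
    ring
  have key := rho_mul_eq_sum_gaussSum_pow k 1 8
  simp_rw [hgauss, hchar'] at key
  rw [hsum] at key
  simp only [Int.cast_one, show (0 : ZMod 8).val = 0 from rfl, show (1 : ZMod 8).val = 1 from rfl,
    show (2 : ZMod 8).val = 2 from rfl, show (3 : ZMod 8).val = 3 from rfl,
    show (4 : ZMod 8).val = 4 from rfl, show (5 : ZMod 8).val = 5 from rfl,
    show (6 : ZMod 8).val = 6 from rfl, show (7 : ZMod 8).val = 7 from rfl,
    show (4 * 0 : ZMod 8) = 0 from rfl, show (4 * 1 : ZMod 8) = 4 from rfl,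
    show (4 * 2 : ZMod 8) = 0 from rfl, show (4 * 3 : ZMod 8) = 4 from rfl,
    show (4 * 4 : ZMod 8) = 0 from rfl, show (4 * 5 : ZMod 8) = 4 from rfl,
    show (4 * 6 : ZMod 8) = 0 from rfl, show (4 * 7 : ZMod 8) = 4 from rfl,
    show (0 * -1 : ZMod 8) = 0 from rfl, show (1 * -1 : ZMod 8) = 7 from rfl,
    show (2 * -1 : ZMod 8) = 6 from rfl, show (3 * -1 : ZMod 8) = 5 from rfl,
    show (4 * -1 : ZMod 8) = 4 from rfl, show (5 * -1 : ZMod 8) = 3 from rfl,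
    show (6 * -1 : ZMod 8) = 2 from rfl, show (7 * -1 : ZMod 8) = 1 from rfl] at key
  have s0 : (2 + 4 * w ^ 0 + 2 * w ^ 0 : ℂ) = 8 := by norm_num
  have s4 : (2 + 4 * w ^ 4 + 2 * w ^ 0 : ℂ) = 0 := by rw [hw4]; norm_num
  have sodd (z : ℂ) : 2 + 4 * z + 2 * w ^ 4 = 4 * z := by rw [hw4]; ring
  have seven (z : ℂ) : 2 + 4 * z + 2 * w ^ 0 = 4 * (1 + z) := by ring
  rw [s0, s4, zero_pow hk.ne', sodd, sodd, sodd, sodd, seven, seven] at key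
  simp only [mul_pow, pow_one] at key
  push_cast at key
  rw [key]
  ring

open Real in
theorem rho_one_eight (k : ℕ) (hk : 0 < k) :
    (rho k 1 8 : ℝ) =
      (2 : ℝ) ^ (2 * (k : ℤ) - 3) *
        ((2 : ℝ) ^ k + (2 : ℝ) ^ ((k : ℝ) / 2 + 1) * Real.sin (π * k / 4)
          + 2 * Real.sin (π * (k + 1) / 4) - 2 * Real.cos (π * (3 * k + 1) / 4)) := by
  obtain ⟨w, hw⟩ : ∃ w : ℂ, w = ZMod.stdAddChar (1 : ZMod 8) := ⟨_, rfl⟩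
  have hexp : w = Complex.exp ((π / 4 : ℝ) * Complex.I) := by
    rw [hw, ← Int.cast_one, ZMod.stdAddChar_coe]
    congr 1
    push_cast
    ring
  have h2 : ((√2 : ℝ) : ℂ) ^ 2 = 2 := by
    norm_cast
    exact Real.sq_sqrt (by norm_num)
  have hI : Complex.I ^ 2 = -1 := Complex.I_sq
  have hcs : w = (√2 : ℝ) / 2 * (1 + Complex.I) := by
    rw [hexp, Complex.exp_mul_I, ← Complex.ofReal_cos, ← Complex.ofReal_sin, cos_pi_div_four,
      sin_pi_div_four]
    push_cast
    ring
  have hw2 : w ^ 2 = Complex.I := by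
    rw [hcs]
    linear_combination (1 + Complex.I) ^ 2 / 4 * h2 + hI / 2
  have hw4 : w ^ 4 = -1 := by linear_combination (w ^ 2 + Complex.I) * hw2 + hI
  have hw3 : w ^ 3 = (√2 : ℝ) / 2 * (-1 + Complex.I) := by
    linear_combination w * hw2 + Complex.I * hcs + (√2 : ℝ) / 2 * hI
  have hw5 : w ^ 5 = (√2 : ℝ) / 2 * (-1 - Complex.I) := by
    linear_combination w * hw4 - hcs
  have hw6 : w ^ 6 = -Complex.I := by linear_combination w ^ 2 * hw4 - hw2
  have hw7 : w ^ 7 = (√2 : ℝ) / 2 * (1 - Complex.I) := by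
    linear_combination w ^ 3 * hw4 - hw3
  have hg2 : 1 + w ^ 2 = (√2 : ℝ) * w := by
    rw [hw2, hcs]
    linear_combination -(1 + Complex.I) / 2 * h2
  have hg6 : 1 + w ^ 6 = (√2 : ℝ) * w ^ 7 := by
    rw [hw6, hw7]
    linear_combination -(1 - Complex.I) / 2 * h2
  have hpow (m : ℤ) (z : ℂ) (hz : z = Complex.exp (m * ((π / 4 : ℝ) * Complex.I))) :
      z ^ k = Real.cos (m * (π * k / 4)) + Real.sin (m * (π * k / 4)) * Complex.I := by
    rw [hz, ← Complex.exp_nat_mul, Complex.ofReal_cos, Complex.ofReal_sin, ← Complex.exp_mul_I]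
    congr 1
    push_cast
    ring
  have hinv (j l : ℕ) (hjl : j + l = 8) :
      w ^ j = Complex.exp ((-l : ℤ) * ((π / 4 : ℝ) * Complex.I)) := by
    rw [Complex.exp_int_mul, ← hexp, zpow_neg, zpow_natCast]
    refine eq_inv_of_mul_eq_one_left ?_
    rw [← pow_add, hjl]
    linear_combination (w ^ 4 - 1) * hw4
  have p1 := hpow 1 w (by simpa using hexp)
  have p3 := hpow 3 (w ^ 3) (by rw [Complex.exp_int_mul, ← hexp]; norm_cast)
  have p5 := hpow _ _ (hinv 5 3 rfl)
  have p7 := hpow _ _ (hinv 7 1 rfl)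
  have key := eight_mul_rho_one_eight hk hw hw4
  rw [hg2, hg6, mul_pow, mul_pow, p1, p3, p5, p7, hw2, hw3, hw5, hw6, hw7, hcs] at key
  have hsin : Real.sin (π * (k + 1) / 4) =
      √2 / 2 * (Real.sin (π * k / 4) + Real.cos (π * k / 4)) := by
    rw [show π * (k + 1) / 4 = π * k / 4 + π / 4 by ring, Real.sin_add, cos_pi_div_four,
      sin_pi_div_four]
    ring
  have hcos : Real.cos (π * (3 * k + 1) / 4) =
      √2 / 2 * (Real.cos (3 * (π * k / 4)) - Real.sin (3 * (π * k / 4))) := by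
    rw [show π * (3 * k + 1) / 4 = 3 * (π * k / 4) + π / 4 by ring, Real.cos_add,
      cos_pi_div_four, sin_pi_div_four]
    ring
  have hsqrt : (2 : ℝ) ^ ((k : ℝ) / 2 + 1) = 2 * √2 ^ k := by
    rw [Real.rpow_add_one (by norm_num), Real.sqrt_eq_rpow, ← Real.rpow_natCast,
      ← Real.rpow_mul (by norm_num), mul_comm]
    ring_nf
  have h4 : (2 : ℝ) ^ (2 * (k : ℤ) - 3) = 4 ^ k / 8 := by
    rw [zpow_sub₀ (by norm_num), zpow_mul]
    norm_num
  have h8 : (8 : ℂ) ^ k = 4 ^ k * 2 ^ k := by rw [← mul_pow]; norm_num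
  rw [hsin, hcos, hsqrt, h4]
  apply Complex.ofReal_injective
  simp only [Int.cast_neg, Int.cast_one, Int.cast_ofNat, Nat.cast_one,
    Nat.cast_ofNat, neg_mul, one_mul, Real.cos_neg, Real.sin_neg, h8] at key
  push_cast at key ⊢
  generalize Complex.cos (3 * (π * k / 4)) = c3 at *
  generalize Complex.sin (3 * (π * k / 4)) = s3 at *
  generalize Complex.cos (π * k / 4) = c at *
  generalize Complex.sin (π * k / 4) = s at *
  generalize ((√2 : ℝ) : ℂ) = r at *
  generalize Complex.I = i at *
  linear_combination key / 8 - 4 ^ k * (r * s / 8 + r * s3 / 8 + r ^ k * s / 4) * hI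
end

section
/- For every positive integer k, the equality ρ_{k,7}(8) = 2^{2k-3} · ( 2^k − 2^{k/2+1}·sin(πk/4) − 2·sin(π(3k+1)/4) + 2·cos(π(k+1)/4) ) holds in the real numbers, where 2^{k/2+1} denotes the real power 2^{k/2+1}. -/
theorem rho_congr (k : ℕ) {lam mu : ℤ} {n : ℕ} (h : (lam : ZMod n) = mu) :
    rho k lam n = rho k mu n := by
  rw [rho, rho, h]

theorem rho_zero_left (lam : ℤ) (n : ℕ) :
    rho 0 lam n = if (lam : ZMod n) = 0 then 1 else 0 := by
  unfold rho
  split_ifs with h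
  · simp [h]
  · simp [Ne.symm h]

theorem rho_succ_left (k : ℕ) (lam : ℤ) (n : ℕ) [NeZero n] :
    rho (k + 1) lam n = ∑ y : ZMod n, rho k (lam - (y.val : ℤ) ^ 2) n := by
  have e : {x : Fin (k + 1) → ZMod n // ∑ i, (x i) ^ 2 = (lam : ZMod n)} ≃
      (y : ZMod n) × {x : Fin k → ZMod n //
        ∑ i, (x i) ^ 2 = ((lam - (y.val : ℤ) ^ 2 : ℤ) : ZMod n)} :=
    { toFun := fun x => ⟨x.1 0, fun i => x.1 i.succ, by
        have := x.2
        rw [Fin.sum_univ_succ] at this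
        simp [← this]⟩
      invFun := fun x => ⟨Fin.cons x.1 x.2.1, by
        rw [Fin.sum_univ_succ]
        simp [x.2.2]⟩
      left_inv := fun x => by
        ext i
        refine Fin.cases ?_ (fun j => ?_) i <;> simp
      right_inv := fun ⟨y, x, hx⟩ => rfl }
  rw [rho, Nat.card_congr e, Nat.card_sigma]
  rfl

theorem rho_succ_left_eight (k : ℕ) (lam : ℤ) :
    rho (k + 1) lam 8 =
      2 * rho k lam 8 + 4 * rho k (lam - 1) 8 + 2 * rho k (lam - 4) 8 := by
  have h0 (m : ℤ) (hm : (m : ZMod 8) = 0) : rho k (lam - m) 8 = rho k lam 8 :=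
    rho_congr k (by push_cast; rw [hm, sub_zero])
  have h1 (m : ℤ) (hm : (m : ZMod 8) = 1) : rho k (lam - m) 8 = rho k (lam - 1) 8 :=
    rho_congr k (by push_cast; rw [hm])
  have h4 (m : ℤ) (hm : (m : ZMod 8) = 4) : rho k (lam - m) 8 = rho k (lam - 4) 8 :=
    rho_congr k (by push_cast; rw [hm])
  rw [rho_succ_left]
  have hsum : ∑ y : ZMod 8, rho k (lam - (y.val : ℤ) ^ 2) 8 =
      rho k (lam - 0) 8 + rho k (lam - 1) 8 + rho k (lam - 4) 8 + rho k (lam - 9) 8 +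
      rho k (lam - 16) 8 + rho k (lam - 25) 8 + rho k (lam - 36) 8 + rho k (lam - 49) 8 :=
    Fin.sum_univ_eight _
  rw [hsum, h0 0 (by decide), h1 9 (by decide), h0 16 (by decide), h1 25 (by decide),
    h4 36 (by decide), h1 49 (by decide)]
  ring

open Real in
theorem eight_mul_indicator_eq_sum_cos (a : ℤ) :
    (8 * (if (a : ZMod 8) = 0 then 1 else 0) : ℝ) =
      1 + 2 * (cos (π * a / 2) + cos (π * a / 4) + cos (3 * (π * a / 4))) + cos (π * a) := by
  have h2 : π * a / 2 = 2 * (π * a / 4) := by ring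
  have h4 : π * a = 2 * (2 * (π * a / 4)) := by ring
  have key : 1 + 2 * (cos (π * a / 2) + cos (π * a / 4) + cos (3 * (π * a / 4))) + cos (π * a) =
      4 * cos (π * a / 4) * (cos (π * a / 4) + 1) * (2 * cos (π * a / 4) ^ 2 - 1) := by
    nth_rewrite 4 [h4]
    rw [h2, cos_two_mul (2 * _), cos_two_mul, cos_three_mul]
    ring
  rw [key]
  have hr : cos (π * a / 4) = cos (π * ((a % 8 : ℤ) : ℝ) / 4) := by
    have ha : (a : ℝ) = ((a % 8 : ℤ) : ℝ) + 8 * ((a / 8 : ℤ) : ℝ) := by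
      exact_mod_cast (Int.emod_add_mul_ediv a 8).symm
    rw [← cos_add_int_mul_two_pi (π * ((a % 8 : ℤ) : ℝ) / 4) (a / 8)]
    congr 1
    linear_combination π / 4 * ha
  have hz : (a : ZMod 8) = 0 ↔ a % 8 = 0 := by
    rw [ZMod.intCast_zmod_eq_zero_iff_dvd]
    exact Int.dvd_iff_emod_eq_zero
  simp only [hz, hr]
  have hlo := Int.emod_nonneg a (show (8 : ℤ) ≠ 0 by norm_num)
  have hhi := Int.emod_lt_of_pos a (show (0 : ℤ) < 8 by norm_num)
  have hs : (√2 : ℝ) ^ 2 = 2 := sq_sqrt (by norm_num)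
  generalize a % 8 = r at hlo hhi
  interval_cases r
  · norm_num
  · simp [cos_pi_div_four, div_pow, hs]; norm_num
  · simp [show π * 2 / 4 = π / 2 by ring]
  · simp [show π * 3 / 4 = π - π / 4 by ring, cos_pi_div_four, div_pow, hs]; norm_num
  · simp
  · simp [show π * 5 / 4 = π / 4 + π by ring, cos_pi_div_four, div_pow, hs]; norm_num
  · simp [show π * 6 / 4 = π / 2 + π by ring, cos_add_pi]
  · simp [show π * 7 / 4 = 2 * π - π / 4 by ring, cos_pi_div_four, div_pow, hs]; norm_num

open Real in
theorem eight_mul_rho_eight (k : ℕ) (a : ℤ) :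
    8 * (rho k a 8 : ℝ) = 8 ^ k + 2 * 4 ^ k * (√2 ^ k * cos (π * (k - 2 * a) / 4) +
      cos (π * (k - a) / 4) + cos (3 * (π * (k - a) / 4))) + 0 ^ k * cos (π * a) := by
  induction k generalizing a with
  | zero =>
    have h := eight_mul_indicator_eq_sum_cos a
    rw [rho_zero_left]
    push_cast
    rw [h, ← cos_neg (π * a / 2), ← cos_neg (π * a / 4), ← cos_neg (3 * (π * a / 4))]
    ring_nf
  | succ k ih =>
    rw [rho_succ_left_eight]
    push_cast
    have e : 8 * (2 * (rho k a 8 : ℝ) + 4 * rho k (a - 1) 8 + 2 * rho k (a - 4) 8) =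
      2 * (8 * (rho k a 8 : ℝ)) + 4 * (8 * rho k (a - 1) 8) + 2 * (8 * rho k (a - 4) 8) := by
      ring
    rw [e, ih, ih, ih]
    push_cast
    have p1 : cos (π * (k - 2 * (a - 1)) / 4) = -sin (π * (k - 2 * a) / 4) := by
      rw [← cos_add_pi_div_two]; ring_nf
    have p2 : cos (π * (k - 2 * (a - 4)) / 4) = cos (π * (k - 2 * a) / 4) := by
      rw [← cos_add_two_pi (π * (k - 2 * a) / 4)]; ring_nf
    have p3 : √2 * cos (π * (k + 1 - 2 * a) / 4) =
        cos (π * (k - 2 * a) / 4) - sin (π * (k - 2 * a) / 4) := by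
      have : π * (k + 1 - 2 * a) / 4 = π * (k - 2 * a) / 4 + π / 4 := by ring
      rw [this, cos_add, cos_pi_div_four, sin_pi_div_four]
      have hs : (√2 : ℝ) ^ 2 = 2 := sq_sqrt (by norm_num)
      linear_combination
        (cos (π * (k - 2 * a) / 4) - sin (π * (k - 2 * a) / 4)) / 2 * hs
    have q1 : (π * (k + 1 - a) / 4 : ℝ) = π * (k - (a - 1)) / 4 := by ring
    have q2 : cos (π * (k - (a - 4)) / 4) = -cos (π * (k - a) / 4) := by
      rw [← cos_add_pi]; ring_nf
    have q3 : cos (3 * (π * (k - (a - 4)) / 4)) = -cos (3 * (π * (k - a) / 4)) := by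
      rw [← cos_add_pi, ← cos_add_two_pi (_ + _)]; ring_nf
    have r1 : cos (π * (a - 1)) = -cos (π * a) := by
      rw [← cos_sub_pi]; ring_nf
    have r2 : cos (π * (a - 4)) = cos (π * a) := by
      rw [← cos_sub_two_pi (π * a), ← cos_sub_two_pi (π * a - 2 * π)]; ring_nf
    rw [p1, p2, q1, q2, q3, r1, r2]
    linear_combination (-8 * 4 ^ k * √2 ^ k) * p3

open Real in
theorem rho_seven_eight (k : ℕ) (hk : 0 < k) :
    (rho k 7 8 : ℝ) =
      (2 : ℝ) ^ (2 * (k : ℤ) - 3) *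
        ((2 : ℝ) ^ k - (2 : ℝ) ^ ((k : ℝ) / 2 + 1) * Real.sin (π * k / 4)
          - 2 * Real.sin (π * (3 * k + 1) / 4) + 2 * Real.cos (π * (k + 1) / 4)) := by
  have h := eight_mul_rho_eight k 7
  rw [zero_pow hk.ne'] at h
  push_cast at h
  have z : (2 : ℝ) ^ (2 * (k : ℤ) - 3) = 4 ^ k / 8 := by
    rw [zpow_sub₀ two_ne_zero, zpow_mul]
    norm_num
  have w : (2 : ℝ) ^ ((k : ℝ) / 2 + 1) = 2 * √2 ^ k := by
    rw [rpow_add two_pos, rpow_one, sqrt_eq_rpow, ← rpow_natCast, ← rpow_mul two_pos.le]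
    ring_nf
  have c1 : cos (π * (k - 2 * 7) / 4) = -sin (π * k / 4) := by
    rw [← cos_add_pi_div_two, ← cos_sub_two_pi (_ + _), ← cos_sub_two_pi (_ - _)]
    ring_nf
  have c2 : cos (π * (k - 7) / 4) = cos (π * (k + 1) / 4) := by
    rw [← cos_sub_two_pi (π * (k + 1) / 4)]
    ring_nf
  have c3 : cos (3 * (π * (k - 7) / 4)) = -sin (π * (3 * k + 1) / 4) := by
    rw [← cos_add_pi_div_two, ← cos_sub_int_mul_two_pi (_ + _) 3]
    push_cast
    ring_nf
  have e8 : (8 : ℝ) ^ k = 4 ^ k * 2 ^ k := by rw [← mul_pow]; norm_num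
  rw [c1, c2, c3, e8] at h
  rw [z, w]
  linear_combination h / 8
end

section
/- Let p be an odd prime, let k be an even positive integer, and let r be a positive integer. Then Φ_k(p^r) = p^{kr − k/2 − 1}·(p−1)·( p^{k/2} − (-1)^{(k/2)·((p-1)/2)} ). -/
/-- `Phi k n` is the number of `k`-tuples `(x_1,…,x_k) ∈ (ℤ/nℤ)^k`
with `gcd(x_1² + ⋯ + x_k², n) = 1`. -/
noncomputable def Phi (k n : ℕ) : ℕ :=
  Nat.card {x : Fin k → ZMod n // Nat.gcd (∑ i, (x i) ^ 2 : ZMod n).val n = 1}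

section SumsOfSquares

variable {F : Type*} [Field F] [Fintype F] [DecidableEq F]

theorem sum_quadraticChar_mul_sub (hF : ringChar F ≠ 2) (t : F) :
    ∑ s : F, quadraticChar F s * quadraticChar F (t - s) =
      quadraticChar F (-1) * ((if t = 0 then (Fintype.card F : ℤ) else 0) - 1) := by
  split_ifs with ht
  · subst ht
    have h : ∀ s : F, quadraticChar F s * quadraticChar F (0 - s) =
        quadraticChar F (-1) * (1 - if s = 0 then 1 else 0) := by
      intro s
      rw [zero_sub, ← neg_one_mul s, map_mul]
      split_ifs with hs
      · simp [hs]
      · linear_combination quadraticChar F (-1) * quadraticChar_sq_one hs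
    simp_rw [h]
    rw [← Finset.mul_sum]
    simp
  · have h := jacobiSum_nontrivial_inv (quadraticChar_ne_one hF)
    rw [(quadraticChar_isQuadratic F).inv, jacobiSum] at h
    rw [← Equiv.sum_comp (Equiv.mulLeft₀ t ht), zero_sub, mul_neg_one, ← h]
    refine Finset.sum_congr rfl fun s _ => ?_
    rw [Equiv.mulLeft₀_apply, show t - t * s = t * (1 - s) by ring, map_mul, map_mul]
    linear_combination (quadraticChar F s * quadraticChar F (1 - s)) * quadraticChar_sq_one ht

theorem sum_comp_sq (hF : ringChar F ≠ 2) (g : F → ℤ) :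
    ∑ c : F, g (c ^ 2) = ∑ t : F, (quadraticChar F t + 1) * g t := by
  rw [← Finset.sum_fiberwise Finset.univ (fun c : F => c ^ 2)]
  refine Finset.sum_congr rfl fun t _ => ?_
  rw [← quadraticChar_card_sqrts hF t, Finset.sum_congr rfl (g := fun _ => g t)
    (fun c hc => by rw [(Finset.mem_filter.mp hc).2]), Finset.sum_const, nsmul_eq_mul]
  congr 3
  ext
  simp

theorem sum_comp_sq_add_sq (hF : ringChar F ≠ 2) (g : F → ℤ) :
    ∑ c : F, ∑ d : F, g (c ^ 2 + d ^ 2) =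
      (Fintype.card F - quadraticChar F (-1)) * ∑ t, g t +
        quadraticChar F (-1) * Fintype.card F * g 0 := by
  have hinner : ∀ t : F, ∑ s : F, (quadraticChar F s + 1) * (quadraticChar F (t - s) + 1) =
      Fintype.card F +
        quadraticChar F (-1) * ((if t = 0 then (Fintype.card F : ℤ) else 0) - 1) := by
    intro t
    have h1 : ∑ s : F, quadraticChar F (t - s) = 0 := by
      rw [← quadraticChar_sum_zero hF]
      exact Equiv.sum_comp (Equiv.subLeft t) (fun s => quadraticChar F s)
    rw [← sum_quadraticChar_mul_sub hF]
    simp only [add_mul, mul_add, one_mul, mul_one, Finset.sum_add_distrib, h1,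
      quadraticChar_sum_zero hF]
    simp
    ring
  calc ∑ c : F, ∑ d : F, g (c ^ 2 + d ^ 2)
      = ∑ s : F, (quadraticChar F s + 1) * ∑ d : F, g (s + d ^ 2) :=
        sum_comp_sq hF fun s => ∑ d : F, g (s + d ^ 2)
    _ = ∑ s : F, ∑ t : F, (quadraticChar F s + 1) * (quadraticChar F (t - s) + 1) * g t := by
        refine Finset.sum_congr rfl fun s _ => ?_
        rw [sum_comp_sq hF fun u => g (s + u), Finset.mul_sum, ← Equiv.sum_comp (Equiv.subRight s)]
        simp [mul_assoc]
    _ = ∑ t : F, (Fintype.card F +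
        quadraticChar F (-1) * ((if t = 0 then (Fintype.card F : ℤ) else 0) - 1)) * g t := by
        rw [Finset.sum_comm]
        simp_rw [← Finset.sum_mul, hinner]
    _ = _ := by
        have h : ∀ t : F, (Fintype.card F +
            quadraticChar F (-1) * ((if t = 0 then (Fintype.card F : ℤ) else 0) - 1)) * g t =
            (Fintype.card F - quadraticChar F (-1)) * g t +
              if t = 0 then quadraticChar F (-1) * Fintype.card F * g t else 0 := by
          intro t
          split_ifs <;> ring
        simp_rw [h, Finset.sum_add_distrib, ← Finset.mul_sum]
        simp

theorem card_mul_sum_comp_sum_sq (hF : ringChar F ≠ 2) (f : F → ℤ) (m : ℕ) :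
    (Fintype.card F : ℤ) * ∑ x : Fin (2 * m) → F, f (∑ i, x i ^ 2) =
      (Fintype.card F : ℤ) ^ (2 * m) * ∑ t, f t +
        (quadraticChar F (-1) * Fintype.card F) ^ m * (Fintype.card F * f 0 - ∑ t, f t) := by
  induction m with
  | zero => simp
  | succ m ih =>
    have hsplit : ∑ x : Fin (2 * (m + 1)) → F, f (∑ i, x i ^ 2) =
        ∑ c : F, ∑ d : F, ∑ x : Fin (2 * m) → F, f (c ^ 2 + d ^ 2 + ∑ i, x i ^ 2) := by
      change ∑ x : Fin (2 * m + 1 + 1) → F, f (∑ i, x i ^ 2) = _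
      rw [← Equiv.sum_comp (Fin.consEquiv fun _ => F), Fintype.sum_prod_type]
      refine Finset.sum_congr rfl fun c _ => ?_
      rw [← Equiv.sum_comp (Fin.consEquiv fun _ => F), Fintype.sum_prod_type]
      simp [Fin.consEquiv, Fin.sum_univ_succ, add_assoc]
    have htrans : ∑ t : F, ∑ x : Fin (2 * m) → F, f (t + ∑ i, x i ^ 2) =
        (Fintype.card F : ℤ) ^ (2 * m) * ∑ t, f t := by
      rw [Finset.sum_comm, Finset.sum_congr rfl (g := fun _ => ∑ t, f t)
        fun x _ => Equiv.sum_comp (Equiv.addRight (∑ i, x i ^ 2)) f]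
      simp
    rw [hsplit, sum_comp_sq_add_sq hF fun t => ∑ x : Fin (2 * m) → F, f (t + ∑ i, x i ^ 2), htrans]
    simp only [zero_add]
    linear_combination (quadraticChar F (-1) * Fintype.card F) * ih

theorem card_mul_card_sum_sq_ne_zero (hF : ringChar F ≠ 2) (m : ℕ) :
    (Fintype.card F : ℤ) * Nat.card {x : Fin (2 * m) → F // ∑ i, x i ^ 2 ≠ 0} =
      (Fintype.card F - 1) * Fintype.card F ^ m *
        ((Fintype.card F : ℤ) ^ m - quadraticChar F (-1) ^ m) := by
  have h := card_mul_sum_comp_sum_sq hF (fun t => if t ≠ 0 then 1 else 0) m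
  have hsum : ∑ t : F, (if t ≠ 0 then 1 else 0 : ℤ) = Fintype.card F - 1 := by
    simp [Finset.sum_ite, Finset.filter_ne', Finset.card_erase_of_mem,
      Nat.cast_sub Fintype.card_pos]
  rw [hsum, Finset.sum_boole] at h
  rw [Nat.card_eq_fintype_card, Fintype.card_subtype, h]
  simp
  ring

end SumsOfSquares

theorem AddMonoidHom.card_mul_card_subtype_comp {G H : Type*} [AddGroup G] [AddGroup H]
    [Finite G] [Finite H] (f : G →+ H) (hf : Function.Surjective f) (P : H → Prop) :
    Nat.card H * Nat.card {x : G // P (f x)} = Nat.card G * Nat.card {y : H // P y} := by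
  have := Fintype.ofFinite G
  have := Fintype.ofFinite H
  classical
  have hfib : ∀ Q : H → Prop, Nat.card {x : G // Q (f x)} =
      Nat.card {y : H // Q y} * (Finset.univ.filter fun x : G => f x = 0).card := by
    intro Q
    simp only [Nat.card_eq_fintype_card, Fintype.card_subtype]
    rw [Finset.card_eq_sum_card_fiberwise (f := f) (t := Finset.univ.filter Q)
      (fun x hx => by simpa using hx)]
    refine Finset.sum_const_nat fun y hy => ?_
    have hQ : Q y := (Finset.mem_filter.mp hy).2
    rw [Finset.filter_filter, ← AddMonoidHom.card_fiber_eq_of_mem_range f (hf y) (hf 0)]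
    congr 1
    ext x
    simp only [Finset.mem_filter, Finset.mem_univ, true_and]
    exact ⟨fun h => h.2, fun h => ⟨h ▸ hQ, h⟩⟩
  have htop := hfib fun _ => True
  simp only [Nat.card_congr (Equiv.subtypeUnivEquiv fun _ => trivial)] at htop
  rw [hfib P, htop]
  ring

theorem ZMod.gcd_val_prime_pow_eq_one_iff {p r : ℕ} (hp : p.Prime) (hr : r ≠ 0)
    (v : ZMod (p ^ r)) :
    Nat.gcd v.val (p ^ r) = 1 ↔ ZMod.castHom (dvd_pow_self p hr) (ZMod p) v ≠ 0 := by
  have : NeZero (p ^ r) := ⟨pow_ne_zero r hp.ne_zero⟩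
  rw [← Nat.coprime_iff_gcd_eq_one, Nat.coprime_pow_right_iff (Nat.pos_of_ne_zero hr),
    Nat.coprime_comm, hp.coprime_iff_not_dvd, ← ZMod.natCast_eq_zero_iff, ZMod.castHom_apply,
    ZMod.natCast_val]

theorem pow_mul_Phi_prime_pow {p r : ℕ} (hp : p.Prime) (hr : r ≠ 0) (k : ℕ) :
    p ^ k * Phi k (p ^ r) =
      p ^ (k * r) * Nat.card {x : Fin k → ZMod p // ∑ i, x i ^ 2 ≠ 0} := by
  have : NeZero (p ^ r) := ⟨pow_ne_zero r hp.ne_zero⟩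
  have : NeZero p := ⟨hp.ne_zero⟩
  let φ := ZMod.castHom (dvd_pow_self p hr) (ZMod p)
  have h := AddMonoidHom.card_mul_card_subtype_comp (φ.toAddMonoidHom.compLeft (Fin k))
    (Function.Surjective.comp_left (ZMod.castHom_surjective (dvd_pow_self p hr)))
    (fun y => ∑ i, y i ^ 2 ≠ 0)
  simp only [Nat.card_fun, Nat.card_zmod, Nat.card_eq_fintype_card (α := Fin k),
    Fintype.card_fin, ← pow_mul] at h
  rw [mul_comm k r, ← h, Phi]
  congr 1
  refine Nat.card_congr (Equiv.subtypeEquivRight fun x => ?_)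
  simp only [ZMod.gcd_val_prime_pow_eq_one_iff hp hr, map_sum, map_pow]
  rfl

theorem Phi_odd_prime_pow_even (p : ℕ) (hp : p.Prime) (hp2 : Odd p)
    (k : ℕ) (hk : 0 < k) (hkeven : Even k) (r : ℕ) (hr : 0 < r) :
    (Phi k (p ^ r) : ℤ) =
      (p : ℤ) ^ (k * r - k / 2 - 1) * ((p : ℤ) - 1) *
        ((p : ℤ) ^ (k / 2) - (-1) ^ ((k / 2) * ((p - 1) / 2))) := by
  have : Fact p.Prime := ⟨hp⟩
  obtain ⟨m, rfl⟩ := hkeven.two_dvd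
  have hF : ringChar (ZMod p) ≠ 2 := by
    rw [ZMod.ringChar_zmod_n]
    rintro rfl
    exact absurd hp2 (by decide)
  have hχ : quadraticChar (ZMod p) (-1) = (-1) ^ ((p - 1) / 2) := by
    rw [quadraticChar_neg_one hF, ZMod.card, ZMod.χ₄_eq_neg_one_pow (Nat.odd_iff.mp hp2)]
    congr 1
    obtain ⟨n, rfl⟩ := hp2
    omega
  have hcount : (p : ℤ) * Nat.card {x : Fin (2 * m) → ZMod p // ∑ i, x i ^ 2 ≠ 0} =
      (p - 1) * p ^ m * ((p : ℤ) ^ m - (-1) ^ (m * ((p - 1) / 2))) := by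
    have h := card_mul_card_sum_sq_ne_zero hF m
    rwa [ZMod.card, hχ, ← pow_mul, mul_comm ((p - 1) / 2) m] at h
  have hlift : (p : ℤ) ^ (2 * m) * Phi (2 * m) (p ^ r) = p ^ (2 * m * r) *
      Nat.card {x : Fin (2 * m) → ZMod p // ∑ i, x i ^ 2 ≠ 0} := by
    exact_mod_cast pow_mul_Phi_prime_pow hp hr.ne' (2 * m)
  have hm : 2 * m / 2 = m := by omega
  have hexp : (2 * m * r - m - 1) + (2 * m + 1) = 2 * m * r + m := by
    have : 2 * m * 1 ≤ 2 * m * r := Nat.mul_le_mul_left _ hr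
    omega
  have hpow : (p : ℤ) ^ (2 * m * r - m - 1) * p ^ (2 * m + 1) = p ^ (2 * m * r) * p ^ m := by
    rw [← pow_add, ← pow_add, hexp]
  rw [hm]
  have hp0 : (p : ℤ) ≠ 0 := Nat.cast_ne_zero.mpr hp.ne_zero
  refine mul_left_cancel₀ (pow_ne_zero (2 * m + 1) hp0) ?_
  linear_combination p * hlift + (p : ℤ) ^ (2 * m * r) * hcount -
    ((p : ℤ) - 1) * ((p : ℤ) ^ m - (-1) ^ (m * ((p - 1) / 2))) * hpow
end

section
/- Let k be an odd positive integer. Then for every positive integer n, Φ_k(n) = n^{k−1}·φ(n). -/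
open Finset in
/-- Under a surjective homomorphism of finite groups, the preimage of a set has proportional
cardinality. -/
theorem card_preimage_mul_card_of_surjective {G H : Type*} [AddGroup G] [AddGroup H] [Fintype G]
    [Fintype H] (f : G →+ H) (hf : Function.Surjective f) (P : H → Prop) :
    Nat.card {g // P (f g)} * Fintype.card H = Nat.card {h // P h} * Fintype.card G := by
  classical
  have hfib : ∀ h : H, #{g | f g = h} = #{g | f g = 0} := fun h =>
    AddMonoidHom.card_fiber_eq_of_mem_range f (hf h) (hf 0)
  have hG : Fintype.card G = Fintype.card H * #{g | f g = 0} := by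
    rw [← Finset.card_univ (α := G),
      card_eq_sum_card_fiberwise (f := f) (t := univ) (fun _ _ => by simp)]
    simp [hfib]
  have hP : #{g | P (f g)} = #{h | P h} * #{g | f g = 0} := by
    rw [card_eq_sum_card_fiberwise (f := f) (t := {h | P h}) (fun _ hx => by simpa using hx)]
    refine sum_const_nat fun h hh => ?_
    rw [← hfib h, filter_filter]
    congr 1
    ext g
    have : P h := by simpa using hh
    simp only [mem_filter, mem_univ, true_and]
    exact ⟨fun h => h.2, fun h => ⟨h ▸ this, h⟩⟩
  rw [Nat.card_eq_fintype_card, Nat.card_eq_fintype_card, Fintype.card_subtype,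
    Fintype.card_subtype, hP, hG]
  ring

theorem Phi_eq_card_isUnit (k n : ℕ) [NeZero n] :
    Phi k n = Nat.card {x : Fin k → ZMod n // IsUnit (∑ i, x i ^ 2)} := by
  refine Nat.card_congr (Equiv.subtypeEquivRight fun x => ?_)
  rw [← Nat.coprime_iff_gcd_eq_one, ← ZMod.isUnit_iff_coprime, ZMod.natCast_zmod_val]

theorem Phi_mul_of_coprime (k : ℕ) {m n : ℕ} [NeZero m] [NeZero n] (h : m.Coprime n) :
    Phi k (m * n) = Phi k m * Phi k n := by
  simp only [Phi_eq_card_isUnit]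
  rw [← Nat.card_prod]
  let e := ZMod.chineseRemainder h
  refine Nat.card_congr (Equiv.trans ?_ Equiv.subtypeProdEquivProd)
  refine Equiv.subtypeEquiv ((Equiv.piCongrRight fun _ => e.toEquiv).trans
    (Equiv.arrowProdEquivProdArrow _ _ _)) fun x => ?_
  rw [← isUnit_map_iff e, Prod.isUnit_iff]
  simp [Equiv.arrowProdEquivProdArrow, Prod.fst_sum, Prod.snd_sum]

theorem Phi_prime_mul_of_dvd (k : ℕ) {p m : ℕ} [NeZero m] (hp : p.Prime) (h : p ∣ m) :
    Phi k (p * m) = p ^ k * Phi k m := by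
  have : NeZero p := ⟨hp.ne_zero⟩
  let f : ZMod (p * m) →+* ZMod m := ZMod.castHom (Nat.dvd_mul_left m p) (ZMod m)
  have hunit : ∀ a, IsUnit (f a) ↔ IsUnit a := fun a => by
    obtain ⟨a, rfl⟩ := ZMod.natCast_zmod_surjective a
    rw [map_natCast, ZMod.isUnit_iff_coprime, ZMod.isUnit_iff_coprime, Nat.coprime_mul_iff_right]
    exact ⟨fun ha => ⟨ha.coprime_dvd_right h, ha⟩, fun ha => ha.2⟩
  have key := card_preimage_mul_card_of_surjective (f.toAddMonoidHom.compLeft (Fin k))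
    ((ZMod.castHom_surjective (Nat.dvd_mul_left m p)).comp_left)
    (fun x => IsUnit (∑ i, x i ^ 2))
  have hcongr : Nat.card {x : Fin k → ZMod (p * m) //
      IsUnit (∑ i, (f.toAddMonoidHom.compLeft (Fin k) x) i ^ 2)} = Phi k (p * m) := by
    rw [Phi_eq_card_isUnit]
    refine Nat.card_congr (Equiv.subtypeEquivRight fun x => ?_)
    rw [← hunit]
    simp
  rw [hcongr, ← Phi_eq_card_isUnit] at key
  simp only [Fintype.card_pi, ZMod.card, Finset.prod_const, Finset.card_univ,
    Fintype.card_fin] at key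
  refine Nat.eq_of_mul_eq_mul_right (pow_pos (NeZero.pos m) k) (key.trans ?_)
  rw [mul_pow]
  ring

section Prime

open Finset

variable (p : ℕ) [Fact p.Prime]

/-- The number of representations of a nonzero element of `ZMod p` as a sum of two squares does
not depend on the element. -/
theorem card_sq_add_sq_eq {d : ZMod p} (hd : d ≠ 0) :
    #{x : ZMod p × ZMod p | x.1 ^ 2 + x.2 ^ 2 = d} =
      #{x : ZMod p × ZMod p | x.1 ^ 2 + x.2 ^ 2 = 1} := by
  obtain ⟨a, b, hab⟩ := ZMod.sq_add_sq p d
  symm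
  refine card_bij' (fun x _ => (a * x.1 - b * x.2, a * x.2 + b * x.1))
    (fun y _ => ((a * y.1 + b * y.2) / d, (a * y.2 - b * y.1) / d)) ?_ ?_ ?_ ?_
  · simp only [mem_filter, mem_univ, true_and]
    intro x hx
    linear_combination hab + (a ^ 2 + b ^ 2) * hx
  · simp only [mem_filter, mem_univ, true_and]
    intro y hy
    field_simp
    linear_combination (y.1 ^ 2 + y.2 ^ 2) * hab + d * hy
  · rintro ⟨x, y⟩ -
    ext <;> simp only <;> field_simp <;> rw [← hab] <;> ring
  · rintro ⟨x, y⟩ -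
    ext <;> simp only <;> field_simp <;> rw [← hab] <;> ring

theorem card_sum_sq_eq_zero_add_two (k : ℕ) :
    #{x : Fin (k + 2) → ZMod p | ∑ i, x i ^ 2 = 0} =
      ∑ x : Fin k → ZMod p, #{y : ZMod p × ZMod p | y.1 ^ 2 + y.2 ^ 2 = -∑ i, x i ^ 2} := by
  simp only [card_filter]
  rw [← (Fin.consEquiv fun _ => ZMod p).sum_comp, Fintype.sum_prod_type]
  simp_rw [← (Fin.consEquiv fun _ : Fin (k + 1) => ZMod p).sum_comp, Fintype.sum_prod_type]
  rw [sum_congr rfl fun a _ => sum_comm, sum_comm]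
  simp [Fin.consEquiv, Fin.sum_univ_succ, eq_neg_iff_add_eq_zero, add_assoc]

/-- A sum of an odd number of squares vanishes on `p ^ (k - 1)` vectors. -/
theorem card_sum_sq_eq_zero_of_odd (m : ℕ) :
    #{x : Fin (2 * m + 1) → ZMod p | ∑ i, x i ^ 2 = 0} = p ^ (2 * m) := by
  induction m with
  | zero =>
    rw [mul_zero, pow_zero, card_eq_one]
    refine ⟨0, ?_⟩
    ext x
    simp [funext_iff, Fin.forall_fin_one]
  | succ m ih =>
    set z := #{y : ZMod p × ZMod p | y.1 ^ 2 + y.2 ^ 2 = 0} with hz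
    set e := #{y : ZMod p × ZMod p | y.1 ^ 2 + y.2 ^ 2 = 1} with he
    have hp : 1 ≤ p := (Fact.out : p.Prime).one_le
    have hfib : ∀ d : ZMod p, #{y : ZMod p × ZMod p | y.1 ^ 2 + y.2 ^ 2 = d} =
        if d = 0 then z else e := fun d => by
      split_ifs with hd
      · rw [hd]
      · exact card_sq_add_sq_eq p hd
    have htotal : z + (p - 1) * e = p ^ 2 := by
      have h := card_eq_sum_card_fiberwise (s := (univ : Finset (ZMod p × ZMod p)))
        (f := fun y => y.1 ^ 2 + y.2 ^ 2) (t := univ) (fun _ _ => by simp)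
      simp only [hfib, sum_ite, sum_const, card_univ, Fintype.card_prod, ZMod.card,
        smul_eq_mul, filter_eq', filter_ne', mem_univ, if_true, card_singleton,
        card_erase_of_mem] at h
      linarith
    have hne : #{x : Fin (2 * m + 1) → ZMod p | ¬ ∑ i, x i ^ 2 = 0} = p ^ (2 * m) * (p - 1) := by
      have h := card_filter_add_card_filter_not (s := univ)
        (fun x : Fin (2 * m + 1) → ZMod p => ∑ i, x i ^ 2 = 0)
      rw [ih, card_univ, Fintype.card_pi, prod_const, ZMod.card, card_univ, Fintype.card_fin,
        pow_succ] at h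
      rw [Nat.mul_sub, mul_one]
      omega
    have hstep := card_sum_sq_eq_zero_add_two p (2 * m + 1)
    simp only [hfib, neg_eq_zero, sum_ite, sum_const, smul_eq_mul, ih, hne] at hstep
    rw [show 2 * (m + 1) + 1 = 2 * m + 1 + 2 by ring, hstep, mul_assoc, ← mul_add, htotal]
    ring

theorem Phi_prime_of_odd (m : ℕ) : Phi (2 * m + 1) p = p ^ (2 * m) * (p - 1) := by
  classical
  rw [Phi_eq_card_isUnit, Nat.card_eq_fintype_card, Fintype.card_subtype]
  simp only [isUnit_iff_ne_zero, ne_eq]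
  have h := card_filter_add_card_filter_not (s := univ)
    (fun x : Fin (2 * m + 1) → ZMod p => ∑ i, x i ^ 2 = 0)
  rw [card_sum_sq_eq_zero_of_odd, card_univ, Fintype.card_pi, prod_const, ZMod.card, card_univ,
    Fintype.card_fin, pow_succ] at h
  rw [Nat.mul_sub, mul_one]
  omega

end Prime

theorem Phi_odd_eq (k : ℕ) (hk : 0 < k) (hkodd : Odd k) (n : ℕ) (hn : 0 < n) :
    Phi k n = n ^ (k - 1) * Nat.totient n := by
  obtain ⟨m, rfl⟩ := hkodd
  rw [Nat.add_sub_cancel]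
  induction n using induction_on_primes with
  | zero => exact absurd hn (lt_irrefl 0)
  | one => simp [Phi]
  | prime_mul p n hp ih =>
    have hn' : 0 < n := Nat.pos_of_mul_pos_left hn
    have : NeZero n := ⟨hn'.ne'⟩
    have : Fact p.Prime := ⟨hp⟩
    by_cases h : p ∣ n
    · rw [Phi_prime_mul_of_dvd _ hp h, ih hn', Nat.totient_mul_of_prime_of_dvd hp h]
      ring
    · have hc : p.Coprime n := (hp.coprime_iff_not_dvd).2 h
      rw [Phi_mul_of_coprime _ hc, Phi_prime_of_odd, ih hn', Nat.totient_mul hc,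
        Nat.totient_prime hp]
      ring
end

section
/- Let k be a positive integer divisible by 4 and let n be a positive integer. Then Φ_k(n)·(2^{k/2} − 1 + (n mod 2)) = n^{k/2−1}·J_{k/2}(n)·φ(n)·2^{k/2}, where (n mod 2) is 1 if n is odd and 0 if n is even. -/
/-- Jordan's totient function: `jordanTotient t n` is the number of `t`-tuples
`(y_1,…,y_t) ∈ (ℤ/nℤ)^t` with `gcd(y_1,…,y_t,n) = 1`. -/
noncomputable def jordanTotient (t n : ℕ) : ℕ :=
  Nat.card {y : Fin t → ZMod n // Nat.gcd (Finset.univ.gcd fun i => (y i).val) n = 1}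

/-- The number of elements satisfying a predicate pulled back along a surjective homomorphism of
finite groups scales with the order of the groups. -/
theorem AddMonoidHom.card_preimage_mul_card {G H : Type*} [AddGroup G] [AddGroup H] [Finite G]
    [Finite H] (f : G →+ H) (hf : Function.Surjective f) (S : H → Prop) :
    Nat.card {g // S (f g)} * Nat.card H = Nat.card {h // S h} * Nat.card G := by
  have key (T : H → Prop) : Nat.card {g // T (f g)} = Nat.card {h // T h} * Nat.card f.ker := by
    rw [← Nat.card_prod]
    refine Nat.card_congr
      ((Equiv.sigmaFiberEquiv (fun g : {g // T (f g)} => (⟨f g.1, g.2⟩ : {h // T h}))).symm.trans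
        ((Equiv.sigmaCongrRight fun h => ?_).trans (Equiv.sigmaEquivProd _ _)))
    refine Equiv.trans ?_ (f.fiberEquivKerOfSurjective hf h.1)
    exact
      { toFun := fun g => ⟨g.1.1, congrArg Subtype.val g.2⟩
        invFun := fun g => ⟨⟨g.1, (show f g.1 = h.1 from g.2).symm ▸ h.2⟩, Subtype.ext g.2⟩
        left_inv := fun _ => rfl
        right_inv := fun _ => rfl }
  have hG : Nat.card G = Nat.card H * Nat.card f.ker := by
    have := key fun _ => True
    rwa [Nat.card_congr (Equiv.subtypeUnivEquiv fun _ => trivial),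
      Nat.card_congr (Equiv.subtypeUnivEquiv fun _ => trivial)] at this
  rw [key, hG]
  ring

theorem ZMod.dvd_val_castHom_iff {n d : ℕ} [NeZero n] (h : d ∣ n) {c : ℕ} (hc : c ∣ d)
    (z : ZMod n) : c ∣ (ZMod.castHom h (ZMod d) z).val ↔ c ∣ z.val := by
  have : (ZMod.castHom h (ZMod d) z).val = z.val % d := by
    conv_lhs => rw [← ZMod.natCast_zmod_val z, map_natCast, ZMod.val_natCast]
  rw [this, Nat.dvd_mod_iff hc]

theorem ZMod.coprime_val_castHom_iff {n d : ℕ} [NeZero n] (h : d ∣ n) (z : ZMod n) :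
    Nat.gcd (ZMod.castHom h (ZMod d) z).val d = 1 ↔ Nat.gcd z.val d = 1 := by
  have : Nat.gcd (ZMod.castHom h (ZMod d) z).val d = Nat.gcd z.val d :=
    Nat.dvd_antisymm
      (Nat.dvd_gcd ((ZMod.dvd_val_castHom_iff h (Nat.gcd_dvd_right _ _) z).1
        (Nat.gcd_dvd_left _ _)) (Nat.gcd_dvd_right _ _))
      (Nat.dvd_gcd ((ZMod.dvd_val_castHom_iff h (Nat.gcd_dvd_right _ _) z).2
        (Nat.gcd_dvd_left _ _)) (Nat.gcd_dvd_right _ _))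
  rw [this]

theorem ZMod.coprime_gcd_val_castHom_iff {ι : Type*} [Fintype ι] {n d : ℕ} [NeZero n]
    (h : d ∣ n) (y : ι → ZMod n) :
    Nat.gcd (Finset.univ.gcd fun i => (ZMod.castHom h (ZMod d) (y i)).val) d = 1 ↔
      Nat.gcd (Finset.univ.gcd fun i => (y i).val) d = 1 := by
  have (c : ℕ) (hc : c ∣ d) :
      c ∣ (Finset.univ.gcd fun i => (ZMod.castHom h (ZMod d) (y i)).val) ↔
        c ∣ (Finset.univ.gcd fun i => (y i).val) := by
    simp only [Finset.dvd_gcd_iff, ZMod.dvd_val_castHom_iff h hc]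
  have : Nat.gcd (Finset.univ.gcd fun i => (ZMod.castHom h (ZMod d) (y i)).val) d =
      Nat.gcd (Finset.univ.gcd fun i => (y i).val) d :=
    Nat.dvd_antisymm
      (Nat.dvd_gcd ((this _ (Nat.gcd_dvd_right _ _)).1 (Nat.gcd_dvd_left _ _))
        (Nat.gcd_dvd_right _ _))
      (Nat.dvd_gcd ((this _ (Nat.gcd_dvd_right _ _)).2 (Nat.gcd_dvd_left _ _))
        (Nat.gcd_dvd_right _ _))
  rw [this]

/-- Chinese remainder theorem for counting tuples subject to a condition that can be checked modulo
each of two coprime factors. -/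
theorem ZMod.card_tuples_mul {ι : Type*} {a b : ℕ} (hab : a.Coprime b)
    (S : (ι → ZMod (a * b)) → Prop) (A : (ι → ZMod a) → Prop) (B : (ι → ZMod b) → Prop)
    (hS : ∀ x, S x ↔ A (fun i => ZMod.castHom (dvd_mul_right a b) (ZMod a) (x i)) ∧
      B (fun i => ZMod.castHom (dvd_mul_left b a) (ZMod b) (x i))) :
    Nat.card {x // S x} = Nat.card {x // A x} * Nat.card {x // B x} := by
  rw [← Nat.card_prod]
  let e : (ι → ZMod (a * b)) ≃ (ι → ZMod a) × (ι → ZMod b) :=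
    (Equiv.piCongrRight fun _ => (ZMod.chineseRemainder hab).toEquiv).trans
      (Equiv.arrowProdEquivProdArrow _ _ _)
  refine Nat.card_congr ((e.subtypeEquiv (q := fun z => A z.1 ∧ B z.2) fun x => ?_).trans
    Equiv.subtypeProdEquivProd)
  have h1 : (e x).1 = fun i => ZMod.castHom (dvd_mul_right a b) (ZMod a) (x i) := by
    funext i
    exact congrArg (fun f : ZMod (a * b) →+* ZMod a => f (x i)) (Subsingleton.elim
      ((RingHom.fst _ _).comp (ZMod.chineseRemainder hab).toRingHom) _)
  have h2 : (e x).2 = fun i => ZMod.castHom (dvd_mul_left b a) (ZMod b) (x i) := by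
    funext i
    exact congrArg (fun f : ZMod (a * b) →+* ZMod b => f (x i)) (Subsingleton.elim
      ((RingHom.snd _ _).comp (ZMod.chineseRemainder hab).toRingHom) _)
  rw [hS, h1, h2]

theorem ZMod.card_tuples_of_dvd {ι : Type*} [Fintype ι] {n d : ℕ} [NeZero n] [NeZero d]
    (h : d ∣ n) (S : (ι → ZMod n) → Prop) (A : (ι → ZMod d) → Prop)
    (hS : ∀ x, S x ↔ A (fun i => ZMod.castHom h (ZMod d) (x i))) :
    Nat.card {x // S x} * d ^ Fintype.card ι = Nat.card {x // A x} * n ^ Fintype.card ι := by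
  have := ((ZMod.castHom h (ZMod d)).toAddMonoidHom.compLeft ι).card_preimage_mul_card
    (fun y => ⟨fun i => (ZMod.castHom_surjective h (y i)).choose,
      funext fun i => (ZMod.castHom_surjective h (y i)).choose_spec⟩) A
  simp only [Nat.card_fun, Nat.card_zmod, Nat.card_eq_fintype_card (α := ι)] at this
  rw [← this]
  congr 1
  exact Nat.card_congr (Equiv.subtypeEquivRight hS)

theorem Phi_mul (k : ℕ) {a b : ℕ} [NeZero a] [NeZero b] (hab : a.Coprime b) :
    Phi k (a * b) = Phi k a * Phi k b := by
  refine ZMod.card_tuples_mul hab _ _ _ fun x => ?_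
  simp only [← map_pow, ← map_sum, ZMod.coprime_val_castHom_iff]
  exact Nat.coprime_mul_iff_right

theorem jordanTotient_mul (t : ℕ) {a b : ℕ} [NeZero a] [NeZero b] (hab : a.Coprime b) :
    jordanTotient t (a * b) = jordanTotient t a * jordanTotient t b := by
  refine ZMod.card_tuples_mul hab _ _ _ fun x => ?_
  simp only [ZMod.coprime_gcd_val_castHom_iff]
  exact Nat.coprime_mul_iff_right

theorem Phi_pow_mul (k p : ℕ) [NeZero p] {e : ℕ} (he : 0 < e) :
    Phi k (p ^ e) * p ^ k = Phi k p * (p ^ e) ^ k := by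
  have := ZMod.card_tuples_of_dvd (ι := Fin k) (dvd_pow_self p he.ne')
    (fun x => Nat.gcd (∑ i, (x i) ^ 2 : ZMod (p ^ e)).val (p ^ e) = 1)
    (fun x => Nat.gcd (∑ i, (x i) ^ 2 : ZMod p).val p = 1) fun x => by
      simp only [← map_pow, ← map_sum, ZMod.coprime_val_castHom_iff]
      exact Nat.coprime_pow_right_iff he _ _
  rwa [Fintype.card_fin] at this

theorem jordanTotient_pow_mul (t p : ℕ) [NeZero p] {e : ℕ} (he : 0 < e) :
    jordanTotient t (p ^ e) * p ^ t = jordanTotient t p * (p ^ e) ^ t := by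
  have := ZMod.card_tuples_of_dvd (ι := Fin t) (dvd_pow_self p he.ne')
    (fun y => Nat.gcd (Finset.univ.gcd fun i => (y i).val) (p ^ e) = 1)
    (fun y => Nat.gcd (Finset.univ.gcd fun i => (y i).val) p = 1) fun x => by
      simp only [ZMod.coprime_gcd_val_castHom_iff]
      exact Nat.coprime_pow_right_iff he _ _
  rwa [Fintype.card_fin] at this

theorem ZMod.coprime_val_prime_iff {p : ℕ} [Fact p.Prime] (z : ZMod p) :
    Nat.gcd z.val p = 1 ↔ z ≠ 0 := by
  rw [← Nat.coprime_iff_gcd_eq_one, Nat.coprime_comm,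
    (Fact.out : p.Prime).coprime_iff_not_dvd, ← ZMod.natCast_eq_zero_iff, ZMod.natCast_zmod_val]

theorem Phi_prime_eq (k p : ℕ) [Fact p.Prime] :
    Phi k p = Nat.card {x : Fin k → ZMod p // ∑ i, (x i) ^ 2 ≠ 0} :=
  Nat.card_congr (Equiv.subtypeEquivRight fun _ => ZMod.coprime_val_prime_iff _)

theorem Nat.card_ne_zero_subtype {α : Type*} [Finite α] [Zero α] :
    Nat.card {x : α // x ≠ 0} = Nat.card α - 1 := by
  classical
  have := Fintype.ofFinite α
  rw [Nat.card_eq_fintype_card, Nat.card_eq_fintype_card, Fintype.card_subtype_compl,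
    Fintype.card_subtype_eq]

theorem jordanTotient_prime (t p : ℕ) [Fact p.Prime] : jordanTotient t p = p ^ t - 1 := by
  have : jordanTotient t p = Nat.card {y : Fin t → ZMod p // y ≠ 0} := by
    refine Nat.card_congr (Equiv.subtypeEquivRight fun y => ?_)
    rw [← Nat.coprime_iff_gcd_eq_one, Nat.coprime_comm,
      (Fact.out : p.Prime).coprime_iff_not_dvd, Finset.dvd_gcd_iff, not_iff_not]
    simp only [Finset.mem_univ, true_implies, ← ZMod.natCast_eq_zero_iff, ZMod.natCast_zmod_val]
    exact funext_iff.symm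
  rw [this, Nat.card_ne_zero_subtype, Nat.card_fun, Nat.card_zmod, Nat.card_fin]

theorem Phi_two {k : ℕ} (hk : 0 < k) : Phi k 2 * 2 = 2 ^ k := by
  rw [Phi_prime_eq]
  let f : (Fin k → ZMod 2) →+ ZMod 2 :=
    { toFun := fun x => ∑ i, x i
      map_zero' := by simp
      map_add' := fun x y => by simp [Finset.sum_add_distrib] }
  have hf : Function.Surjective f := fun z =>
    ⟨Pi.single ⟨0, hk⟩ z, by simp [f]⟩
  have := f.card_preimage_mul_card hf (· ≠ 0)
  rw [Nat.card_ne_zero_subtype, Nat.card_fun, Nat.card_zmod, Nat.card_fin] at this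
  rw [show (2 - 1) * 2 ^ k = 2 ^ k by simp] at this
  rw [← this]
  congr 2
  simp only [f, ZMod.pow_card, AddMonoidHom.coe_mk, ZeroHom.coe_mk]

/-- The number of pairs of vectors over a finite field on which the dot product is nonzero. -/
theorem card_dotProduct_ne_zero {F ι : Type*} [Field F] [Finite F] [Fintype ι] :
    Nat.card {w : (ι → F) × (ι → F) // ∑ i, w.1 i * w.2 i ≠ 0} * Nat.card F =
      (Nat.card F ^ Fintype.card ι - 1) * (Nat.card F - 1) * Nat.card F ^ Fintype.card ι := by
  classical
  have := Fintype.ofFinite F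
  have hfib (u : ι → F) (hu : u ≠ 0) : Nat.card {v : ι → F // ∑ i, u i * v i ≠ 0} * Nat.card F =
      (Nat.card F - 1) * Nat.card F ^ Fintype.card ι := by
    let f : (ι → F) →+ F :=
      { toFun := fun v => ∑ i, u i * v i
        map_zero' := by simp
        map_add' := fun x y => by simp [mul_add, Finset.sum_add_distrib] }
    obtain ⟨i, hi⟩ := Function.ne_iff.1 hu
    have hf : Function.Surjective f := fun z =>
      ⟨Pi.single i ((u i)⁻¹ * z), by
        have hi' : u i ≠ 0 := hi
        simp [f, Pi.single_apply, hi']⟩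
    have := f.card_preimage_mul_card hf (· ≠ 0)
    rw [Nat.card_ne_zero_subtype, Nat.card_fun, Nat.card_eq_fintype_card (α := ι)] at this
    exact this
  let e : {w : (ι → F) × (ι → F) // ∑ i, w.1 i * w.2 i ≠ 0} ≃
      Σ u : ι → F, {v : ι → F // ∑ i, u i * v i ≠ 0} :=
    { toFun := fun w => ⟨w.1.1, w.1.2, w.2⟩
      invFun := fun w => ⟨(w.1, w.2.1), w.2.2⟩
      left_inv := fun _ => rfl
      right_inv := fun _ => rfl }
  rw [Nat.card_congr e, Nat.card_sigma, Finset.sum_mul,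
    ← Finset.add_sum_erase _ _ (Finset.mem_univ (0 : ι → F)),
    Finset.sum_congr rfl fun u hu => hfib u (Finset.ne_of_mem_erase hu)]
  simp [Finset.card_erase_of_mem, mul_assoc]

/-- Over a field of odd characteristic in which `-1` is a sum of two squares, a sum of `4 j` squares
is equivalent to a sum of `2 j` hyperbolic planes. -/
theorem card_sum_sq_ne_zero_eq {F J : Type*} [Field F] [Fintype J] (h2 : (2 : F) ≠ 0) {a b : F}
    (hab : a ^ 2 + b ^ 2 = -1) :
    Nat.card {x : (J ⊕ J) ⊕ (J ⊕ J) → F // ∑ i, (x i) ^ 2 ≠ 0} =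
      Nat.card {w : (J ⊕ J → F) × (J ⊕ J → F) // ∑ i, w.1 i * w.2 i ≠ 0} := by
  let e : ((J ⊕ J) ⊕ (J ⊕ J) → F) ≃ (J ⊕ J → F) × (J ⊕ J → F) :=
    { toFun := fun x =>
        (Sum.elim
          (fun i => x (.inl (.inl i)) + (a * x (.inr (.inl i)) - b * x (.inr (.inr i))))
          (fun i => x (.inl (.inr i)) + (b * x (.inr (.inl i)) + a * x (.inr (.inr i)))),
        Sum.elim
          (fun i => x (.inl (.inl i)) - (a * x (.inr (.inl i)) - b * x (.inr (.inr i))))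
          (fun i => x (.inl (.inr i)) - (b * x (.inr (.inl i)) + a * x (.inr (.inr i)))))
      invFun := fun w =>
        Sum.elim (fun i => (w.1 i + w.2 i) / 2)
          (Sum.elim
            (fun i => -(a * ((w.1 (.inl i) - w.2 (.inl i)) / 2) +
              b * ((w.1 (.inr i) - w.2 (.inr i)) / 2)))
            (fun i => -(a * ((w.1 (.inr i) - w.2 (.inr i)) / 2) -
              b * ((w.1 (.inl i) - w.2 (.inl i)) / 2))))
      left_inv := fun x => by
        funext i
        rcases i with (i | i) | (i | i)
        · simp only [Sum.elim_inl, Sum.elim_inr]; field_simp; ring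
        · simp only [Sum.elim_inl, Sum.elim_inr]; field_simp; ring
        · simp only [Sum.elim_inl, Sum.elim_inr]; field_simp
          linear_combination (-2 * x (.inr (.inl i))) * hab
        · simp only [Sum.elim_inl, Sum.elim_inr]; field_simp
          linear_combination (-2 * x (.inr (.inr i))) * hab
      right_inv := fun w => by
        refine Prod.ext (funext ?_) (funext ?_) <;> rintro (i | i) <;>
          simp only [Sum.elim_inl, Sum.elim_inr] <;> field_simp
        · linear_combination (-(w.1 (.inl i) - w.2 (.inl i))) * hab
        · linear_combination (-(w.1 (.inr i) - w.2 (.inr i))) * hab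
        · linear_combination ((w.1 (.inl i) - w.2 (.inl i))) * hab
        · linear_combination ((w.1 (.inr i) - w.2 (.inr i))) * hab }
  refine Nat.card_congr (e.subtypeEquiv fun x => ?_)
  have : ∑ i, (x i) ^ 2 = ∑ i, (e x).1 i * (e x).2 i := by
    simp only [Fintype.sum_sum_type, e, Equiv.coe_fn_mk, Sum.elim_inl, Sum.elim_inr,
      ← Finset.sum_add_distrib]
    refine Finset.sum_congr rfl fun i _ => ?_
    linear_combination (x (.inr (.inl i)) ^ 2 + x (.inr (.inr i)) ^ 2) * hab
  rw [this]

theorem Phi_odd_prime (j p : ℕ) [Fact p.Prime] (hp : p ≠ 2) :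
    Phi (4 * j) p * p = (p ^ (2 * j) - 1) * (p - 1) * p ^ (2 * j) := by
  have h2 : (2 : ZMod p) ≠ 0 := by
    have : p.Prime := Fact.out
    intro h
    have h' : ((2 : ℕ) : ZMod p) = 0 := by exact_mod_cast h
    rw [ZMod.natCast_eq_zero_iff] at h'
    exact hp ((Nat.prime_dvd_prime_iff_eq this Nat.prime_two).1 h')
  obtain ⟨a, b, hab⟩ := ZMod.sq_add_sq p (-1)
  let e : Fin (4 * j) ≃ (Fin j ⊕ Fin j) ⊕ (Fin j ⊕ Fin j) :=
    Fintype.equivOfCardEq (by simp; ring)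
  have h1 : Phi (4 * j) p =
      Nat.card {x : (Fin j ⊕ Fin j) ⊕ (Fin j ⊕ Fin j) → ZMod p // ∑ i, (x i) ^ 2 ≠ 0} := by
    rw [Phi_prime_eq]
    refine Nat.card_congr ((e.arrowCongr (Equiv.refl _)).subtypeEquiv fun x => ?_)
    rw [← e.sum_comp]
    simp
  have := card_dotProduct_ne_zero (F := ZMod p) (ι := Fin j ⊕ Fin j)
  rw [← card_sum_sq_ne_zero_eq h2 hab, ← h1] at this
  simpa [Nat.card_zmod, two_mul] using this

theorem Phi_jordan_prime (j p : ℕ) (hj : 0 < j) [Fact p.Prime] :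
    Phi (4 * j) p * (2 ^ (2 * j) - 1 + p % 2) =
      p ^ (2 * j - 1) * jordanTotient (2 * j) p * (p - 1) * 2 ^ (2 * j) := by
  have hp : p.Prime := Fact.out
  refine Nat.eq_of_mul_eq_mul_right hp.pos ?_
  obtain ⟨m, hm⟩ : ∃ m, 2 * j = m + 1 := ⟨2 * j - 1, by lia⟩
  rw [jordanTotient_prime]
  rcases hp.eq_two_or_odd with rfl | hodd
  · have := Phi_two (k := 4 * j) (by lia)
    rw [mul_right_comm, this, show 4 * j = 2 * j + 2 * j by ring, hm, Nat.add_sub_cancel]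
    simp only [Nat.mod_self, add_zero, Nat.add_one_sub_one, mul_one]
    ring
  · have := Phi_odd_prime j p (by rintro rfl; simp at hodd)
    rw [hodd, Nat.sub_add_cancel Nat.one_le_two_pow, mul_right_comm, this, hm,
      Nat.add_sub_cancel]
    ring

theorem Phi_jordan_prime_pow (j p e : ℕ) (hj : 0 < j) (hp : p.Prime) (he : 0 < e) :
    Phi (4 * j) (p ^ e) * (2 ^ (2 * j) - 1 + p ^ e % 2) =
      (p ^ e) ^ (2 * j - 1) * jordanTotient (2 * j) (p ^ e) * Nat.totient (p ^ e) *
        2 ^ (2 * j) := by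
  have := Fact.mk hp
  have hprime := Phi_jordan_prime j p hj
  have hPhi := Phi_pow_mul (4 * j) p he
  have hJ := jordanTotient_pow_mul (2 * j) p he
  have hphi : Nat.totient (p ^ e) * p = (p - 1) * p ^ e := by
    rw [Nat.totient_prime_pow hp he, mul_right_comm, ← pow_succ, Nat.sub_add_cancel he, mul_comm]
  have hmod : p ^ e % 2 = p % 2 := by
    rcases hp.eq_two_or_odd with rfl | hodd
    · exact Nat.mod_eq_zero_of_dvd (dvd_pow_self 2 he.ne')
    · rw [Nat.pow_mod, hodd, one_pow, Nat.one_mod]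
  rw [hmod]
  refine Nat.eq_of_mul_eq_mul_right (pow_pos hp.pos (4 * j)) ?_
  obtain ⟨m, hm⟩ : ∃ m, 2 * j = m + 1 := ⟨2 * j - 1, by lia⟩
  have h4 : 4 * j = m + (m + 1) + 1 := by lia
  rw [mul_right_comm, hPhi, mul_right_comm, hprime]
  rw [hm] at hJ ⊢
  rw [h4, Nat.add_sub_cancel]
  calc _ = (p ^ e) ^ m * (jordanTotient (m + 1) p * (p ^ e) ^ (m + 1)) * ((p - 1) * p ^ e) *
        2 ^ (m + 1) * p ^ m := by ring
    _ = _ := by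
      rw [← hJ, ← hphi]
      ring

theorem Phi_jordan (k : ℕ) (hk : 0 < k) (h4 : 4 ∣ k) (n : ℕ) (hn : 0 < n) :
    Phi k n * (2 ^ (k / 2) - 1 + n % 2) =
      n ^ (k / 2 - 1) * jordanTotient (k / 2) n * Nat.totient n * 2 ^ (k / 2) := by
  obtain ⟨j, rfl⟩ := h4
  have hj : 0 < j := by lia
  rw [show 4 * j / 2 = 2 * j by lia]
  induction n using Nat.recOnPosPrimePosCoprime with
  | zero => exact absurd hn (lt_irrefl 0)
  | one => simp [Phi, jordanTotient, Nat.one_le_two_pow]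
  | prime_pow p e hp he => exact Phi_jordan_prime_pow j p e hj hp he
  | coprime a b ha hb hab iha ihb =>
    have : NeZero a := ⟨by lia⟩
    have : NeZero b := ⟨by lia⟩
    have hc : (2 ^ (2 * j) - 1 + a * b % 2) * 2 ^ (2 * j) =
        (2 ^ (2 * j) - 1 + a % 2) * (2 ^ (2 * j) - 1 + b % 2) := by
      obtain ⟨c, hc⟩ : ∃ c, 2 ^ (2 * j) = c + 1 :=
        Nat.exists_eq_succ_of_ne_zero (pow_pos two_pos _).ne'
      rw [hc, Nat.add_sub_cancel]
      rcases Nat.mod_two_eq_zero_or_one a with h | h <;>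
        rcases Nat.mod_two_eq_zero_or_one b with h' | h'
      · exact absurd (Nat.dvd_gcd (Nat.dvd_of_mod_eq_zero h) (Nat.dvd_of_mod_eq_zero h'))
          (by rw [hab]; decide)
      all_goals simp [Nat.mul_mod, h, h', mul_comm]
    refine Nat.eq_of_mul_eq_mul_right (pow_pos two_pos (2 * j)) ?_
    rw [Phi_mul _ hab, jordanTotient_mul _ hab, Nat.totient_mul hab, mul_assoc, hc]
    calc _ = (Phi (4 * j) a * (2 ^ (2 * j) - 1 + a % 2)) *
          (Phi (4 * j) b * (2 ^ (2 * j) - 1 + b % 2)) := by ring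
      _ = _ := by
        rw [iha (by lia), ihb (by lia)]
        ring
end
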